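/- Let G be a cactus graph with at least one edge. Then G contains a subgraph H which is either a single edge or a simple cycle, such that at most one vertex of H is adjacent in G to a vertex not in H. Precisely: there exists a subset S of the vertex set of G such that either S = {a, b} for two adjacent vertices a ≠ b, or S is the vertex set of a simple cycle of G, and the set {v ∈ S : G has an edge from v to a vertex outside S} has at most one element. -/

import Mathlib

/-- A cactus graph: a finite connected simple graph in which any two simple cycles share
at most one vertex; equivalently, any two simple cycles sharing two distinct vertices
are the same cycle (have the same edge set). -/
def IsCactusGraph {V : Type} (G : SimpleGraph V) : Prop :=
  Finite V ∧ G.Connected ∧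
  ∀ ⦃u v : V⦄ (c₁ : G.Walk u u) (c₂ : G.Walk v v), c₁.IsCycle → c₂.IsCycle →
    (∃ x y : V, x ≠ y ∧ x ∈ c₁.support ∧ x ∈ c₂.support ∧
      y ∈ c₁.support ∧ y ∈ c₂.support) →
    {e | e ∈ c₁.edges} = {e | e ∈ c₂.edges}

open SimpleGraph

/-- Cut a walk at its first vertex in `Z`. -/
lemma first_hit {V : Type} {G : SimpleGraph V} (Z : Set V) {a b : V} (p : G.Walk a b)
    (hb : b ∈ Z) : ∃ x ∈ Z, ∃ q : G.Walk a x,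
      (∀ y ∈ q.support, y ∈ p.support) ∧ ∀ y ∈ q.support, y ∈ Z → y = x := by
  induction p with
  | nil => exact ⟨_, hb, Walk.nil, by simp, by simp⟩
  | @cons u v w h p ih =>
    by_cases hu : u ∈ Z
    · exact ⟨u, hu, Walk.nil, by simp, by simp⟩
    · obtain ⟨x, hx, q, h1, h2⟩ := ih hb
      refine ⟨x, hx, Walk.cons h q, ?_, ?_⟩
      · intro y hy
        simp only [Walk.support_cons, List.mem_cons] at hy ⊢
        exact hy.imp id (h1 y)
      · intro y hy hyZ
        simp only [Walk.support_cons, List.mem_cons] at hy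
        rcases hy with rfl | hy
        · exact absurd hyZ hu
        · exact h2 y hy hyZ

lemma append_path {V : Type} {G : SimpleGraph V} {a b c : V} (p : G.Walk a b)
    (q : G.Walk b c) (hp : p.IsPath) (hq : q.IsPath)
    (h : ∀ y ∈ p.support, y ∈ q.support → y = b) : (p.append q).IsPath := by
  induction p with
  | nil => simpa using hq
  | @cons u v w e p ih =>
    rw [Walk.cons_isPath_iff] at hp
    rw [Walk.cons_append, Walk.cons_isPath_iff]
    refine ⟨ih q hp.1 hq fun y hy => h y (by simp [hy]), ?_⟩
    rw [Walk.mem_support_append_iff]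
    rintro (h1 | h1)
    · exact hp.2 h1
    · have := h u (by simp) h1
      subst this
      exact hp.2 p.end_mem_support

/-- In a cactus, a cycle has no ear. -/
lemma no_ear {V : Type} {G : SimpleGraph V} (hG : IsCactusGraph G) {r z w v : V}
    (c : G.Walk r r) (hc : c.IsCycle) (hz : z ∈ c.support) (hv : v ∈ c.support)
    (hw : w ∉ c.support) (hzw : G.Adj z w) (p : G.Walk w v) (hp : z ∉ p.support) : False := by
  classical
  obtain ⟨x, hx, q, h1, h2⟩ := first_hit {y | y ∈ c.support} p hv
  have hx' : x ∈ (c.rotate z hz).support := (Walk.mem_support_rotate_iff ..).2 hx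
  have hc' : (c.rotate z hz).IsCycle := hc.rotate hz
  have hsub : ∀ y ∈ ((c.rotate z hz).takeUntil x hx').support, y ∈ c.support := fun y hy =>
    (Walk.mem_support_rotate_iff ..).1 (Walk.support_takeUntil_subset_support _ _ hy)
  set t := (c.rotate z hz).takeUntil x hx' with ht
  have htp : t.IsPath := hc'.isPath_takeUntil hx'
  have hb : ∀ y ∈ q.bypass.support, y ∈ q.support := fun y hy =>
    q.support_bypass_subset_support hy
  have hzq : z ∉ q.bypass.support := fun h => hp (h1 _ (hb _ h))
  have hcyc : (Walk.cons hzw (q.bypass.append t.reverse)).IsCycle := by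
    rw [Walk.cons_isCycle_iff]
    refine ⟨append_path _ _ q.bypass_isPath htp.reverse ?_, ?_⟩
    · intro y hy hy'
      exact h2 y (hb y hy) (hsub y (by simpa using hy'))
    · rw [Walk.edges_append, List.mem_append]
      rintro (h | h)
      · exact hzq (Walk.fst_mem_support_of_mem_edges _ h)
      · have := Walk.snd_mem_support_of_mem_edges _ h
        exact hw (hsub w (by simpa using this))
  have key := hG.2.2 c _ hc hcyc ⟨x, z, ?_, hx, ?_, hz, ?_⟩
  · have : s(z, w) ∈ {e | e ∈ c.edges} := by
      rw [key]; simp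
    exact hw (Walk.snd_mem_support_of_mem_edges _ this)
  · rintro rfl
    exact hp (h1 _ q.end_mem_support)
  · simp [Walk.mem_support_append_iff]
  · simp

/-- Vertices reachable from `w` while avoiding `v`. -/
def avoidReach {V : Type} (G : SimpleGraph V) (v w : V) : Set V :=
  {x | ∃ p : G.Walk w x, v ∉ p.support}

lemma avoidReach_ne {V : Type} {G : SimpleGraph V} {v w x : V} (h : x ∈ avoidReach G v w) :
    x ≠ v := by
  obtain ⟨p, hp⟩ := h
  rintro rfl
  exact hp p.end_mem_support

lemma avoidReach_trans {V : Type} {G : SimpleGraph V} {v a b x : V}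
    (h : b ∈ avoidReach G v a) (h' : x ∈ avoidReach G v b) : x ∈ avoidReach G v a := by
  obtain ⟨p, hp⟩ := h
  obtain ⟨q, hq⟩ := h'
  exact ⟨p.append q, by rw [Walk.mem_support_append_iff]; tauto⟩

lemma avoidReach_symm {V : Type} {G : SimpleGraph V} {v a b : V}
    (h : b ∈ avoidReach G v a) : a ∈ avoidReach G v b := by
  obtain ⟨p, hp⟩ := h
  exact ⟨p.reverse, by simpa using hp⟩

lemma avoidReach_adj {V : Type} {G : SimpleGraph V} {v a b : V} (h : G.Adj a b)
    (ha : a ≠ v) (hb : b ≠ v) : b ∈ avoidReach G v a :=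
  ⟨Walk.cons h Walk.nil, by simp [ha.symm, hb.symm]⟩


/-- Every cactus graph with at least one edge contains a subgraph `H`
which is either a single edge or a simple cycle, such that at most one vertex of `H` is
adjacent to a vertex outside `H`. -/
theorem cactus_graph_has_pendant_piece {V : Type} (G : SimpleGraph V)
    (hG : IsCactusGraph G) (hedge : ∃ a b : V, G.Adj a b) :
    ∃ S : Set V,
      ((∃ a b : V, a ≠ b ∧ G.Adj a b ∧ S = {a, b}) ∨
        (∃ (v : V) (c : G.Walk v v), c.IsCycle ∧ S = {x | x ∈ c.support})) ∧
      {v ∈ S | ∃ w ∉ S, G.Adj v w}.Subsingleton := by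
  classical
  have : Finite V := hG.1
  obtain ⟨a, b, hab⟩ := hedge
  let P : Set (V × V) := {x | x.2 ≠ x.1}
  have hPn : P.Nonempty := ⟨(a, b), hab.ne'⟩
  obtain ⟨⟨v, w⟩, hvw, hmin⟩ :=
    Set.exists_min_image P (fun x => (avoidReach G x.1 x.2).ncard) P.toFinite hPn
  replace hvw : w ≠ v := hvw
  set C := avoidReach G v w with hC
  -- minimality: no vertex of `C` separates a neighbour inside `C` from `v`
  have hkey : ∀ z ∈ C, ∀ y ∈ C, y ≠ z → v ∈ avoidReach G z y := by
    intro z hz y hy hyz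
    by_contra hcon
    have h1 : C.ncard ≤ (avoidReach G z y).ncard := hmin (z, y) hyz
    have h2 : avoidReach G z y ⊂ C := by
      refine ⟨?_, fun hh => avoidReach_ne (hh hz) rfl⟩
      rintro x ⟨p, hp⟩
      refine avoidReach_trans hy ⟨p, fun hv => hcon ⟨p.takeUntil v hv, fun hh => ?_⟩⟩
      exact hp (p.support_takeUntil_subset_support hv hh)
    exact absurd (Set.ncard_lt_ncard h2 (Set.toFinite _)) (by omega)
  have hwC : w ∈ C := ⟨Walk.nil, by simpa using hvw.symm⟩
  have hstep : ∀ x ∈ C, ∀ y, G.Adj x y → y ≠ v → y ∈ C := fun x hx y hxy hy =>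
    avoidReach_trans hx (avoidReach_adj hxy (avoidReach_ne hx) hy)
  -- a neighbour of `v` in `C`
  obtain ⟨u, huC, huv⟩ : ∃ u ∈ C, G.Adj u v := by
    obtain ⟨p⟩ := hG.2.1.preconnected w v
    obtain ⟨d, -, hd1, hd2⟩ := p.exists_boundary_dart C hwC (fun h => avoidReach_ne h rfl)
    refine ⟨d.fst, hd1, ?_⟩
    have : d.snd = v := by
      by_contra hne
      exact hd2 (hstep _ hd1 _ d.adj hne)
    rw [← this]; exact d.adj
  by_cases hu : ∃ y ∈ C, G.Adj u y
  · obtain ⟨y, hyC, huy⟩ := hu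
    obtain ⟨p, hp⟩ := hkey u huC y hyC huy.ne'
    have hpu : u ∉ p.bypass.support := fun h => hp (p.support_bypass_subset_support h)
    have hpath := p.bypass_isPath
    set q := p.bypass with hq
    have hcyc : (Walk.cons huy (q.append (Walk.cons huv.symm Walk.nil))).IsCycle := by
      rw [Walk.cons_isCycle_iff]
      refine ⟨append_path _ _ hpath (by simp [huv.ne']) ?_, ?_⟩
      · intro t ht ht'
        simp only [Walk.support_cons, Walk.support_nil, List.mem_cons, List.not_mem_nil,
          or_false] at ht'
        rcases ht' with h | rfl
        · exact h
        · exact absurd ht hpu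
      · rw [Walk.edges_append, List.mem_append]
        rintro (h | h)
        · exact hpu (Walk.fst_mem_support_of_mem_edges _ h)
        · simp only [Walk.edges_cons, Walk.edges_nil, List.mem_cons, List.not_mem_nil,
            or_false, Sym2.eq_iff] at h
          have := avoidReach_ne huC
          have := avoidReach_ne hyC
          tauto
    set c := Walk.cons huy (q.append (Walk.cons huv.symm Walk.nil)) with hcdef
    have hvc : v ∈ c.support := by simp [hcdef, Walk.mem_support_append_iff]
    have hcC : ∀ t ∈ c.support, t ≠ v → t ∈ C := by
      intro t ht htv
      simp only [hcdef, Walk.support_cons, List.mem_cons, Walk.mem_support_append_iff,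
        Walk.support_nil, List.not_mem_nil, or_false] at ht
      have hmain : t ∈ q.support → t ∈ C := fun h => by
        refine avoidReach_trans hyC ⟨q.takeUntil t h, fun hh => ?_⟩
        exact Walk.endpoint_notMem_support_takeUntil hpath h htv.symm hh
      rcases ht with rfl | ht | rfl | rfl
      · exact huC
      · exact hmain ht
      · exact absurd rfl htv
      · exact huC
    refine ⟨{x | x ∈ c.support}, Or.inr ⟨u, c, hcyc, rfl⟩, ?_⟩
    have hone : ∀ t ∈ {t ∈ {x | x ∈ c.support} | ∃ s ∉ {x | x ∈ c.support}, G.Adj t s},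
        t = v := by
      rintro t ⟨ht, s, hs, hts⟩
      by_contra htv
      have htC := hcC t ht htv
      have hsv : s ≠ v := by rintro rfl; exact hs hvc
      obtain ⟨p', hp'⟩ := hkey t htC s (hstep t htC s hts hsv) hts.ne'
      exact no_ear hG c hcyc ht hvc hs hts p' hp'
    intro x hx y hy
    rw [hone x hx, hone y hy]
  · refine ⟨{u, v}, Or.inl ⟨u, v, huv.ne, huv, rfl⟩, ?_⟩
    have hone : ∀ t ∈ {t ∈ ({u, v} : Set V) | ∃ s ∉ ({u, v} : Set V), G.Adj t s}, t = v := by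
      rintro t ⟨ht, s, hs, hts⟩
      rcases ht with rfl | ht
      · refine absurd ⟨s, hstep _ huC s hts ?_, hts⟩ hu
        rintro rfl; simp at hs
      · exact ht
    intro x hx y hy
    rw [hone x hx, hone y hy]
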